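/- A subset X ⊆ A^ℤ is a sofic-Dyck shift over a pushdown alphabet A if and only if X = X_F for some visibly pushdown language F over A, where X_F denotes the set of bi-infinite sequences over A none of whose finite factors belongs to F. -/

import Mathlib

namespace SD

/-- The three kinds of letters of a pushdown alphabet. -/
inductive LetterKind : Type
  | call
  | ret
  | intern
  deriving DecidableEq

/-- A pushdown alphabet structure on `A`: a partition of the letters into
call letters, return letters and internal letters. -/
structure PushdownAlphabet (A : Type*) where
  kind : A → LetterKind

/-- Number of call letters of a word. -/
def callCount {A : Type*} (P : PushdownAlphabet A) (u : List A) : ℕ :=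
  u.countP (fun a => decide (P.kind a = LetterKind.call))

/-- Number of return letters of a word. -/
def retCount {A : Type*} (P : PushdownAlphabet A) (u : List A) : ℕ :=
  u.countP (fun a => decide (P.kind a = LetterKind.ret))

/-- A word is matched-return if every prefix has at least as many call letters
as return letters. -/
def MatchedReturn {A : Type*} (P : PushdownAlphabet A) (u : List A) : Prop :=
  ∀ v w : List A, u = v ++ w → retCount P v ≤ callCount P v

/-- A word is matched-call if every suffix has at least as many return letters
as call letters. -/
def MatchedCall {A : Type*} (P : PushdownAlphabet A) (u : List A) : Prop :=
  ∀ v w : List A, u = v ++ w → callCount P w ≤ retCount P w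

/-- A Dyck word is a word which is both matched-return and matched-call. -/
def IsDyck {A : Type*} (P : PushdownAlphabet A) (u : List A) : Prop :=
  MatchedReturn P u ∧ MatchedCall P u

/-- The factor of length `n` of a bi-infinite sequence starting at position `i`. -/
def factorAt {A : Type*} (x : ℤ → A) (i : ℤ) (n : ℕ) : List A :=
  (List.range n).map (fun k => x (i + (k : ℤ)))

/-- `w` is a (finite) factor of the bi-infinite sequence `x`. -/
def IsFactorOf {A : Type*} (w : List A) (x : ℤ → A) : Prop :=
  ∃ i : ℤ, w = factorAt x i w.length

/-- A Dyck automaton over alphabet `A` with states `Q`: a labeled graph together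
with a set of matched pairs of edges. -/
structure DyckAutomaton (A : Type*) (Q : Type*) where
  edges : Set (Q × A × Q)
  matched : Set ((Q × A × Q) × (Q × A × Q))

/-- Well-formedness of a Dyck automaton: matched pairs consist of edges of the
automaton, a call edge followed by a return edge. -/
def DyckAutomaton.WellFormed {A Q : Type*} (P : PushdownAlphabet A)
    (𝒜 : DyckAutomaton A Q) : Prop :=
  ∀ e f : Q × A × Q, (e, f) ∈ 𝒜.matched →
    e ∈ 𝒜.edges ∧ f ∈ 𝒜.edges ∧
    P.kind e.2.1 = LetterKind.call ∧ P.kind f.2.1 = LetterKind.ret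

/-- The label of a finite path. -/
def pathLabel {A Q : Type*} (π : List (Q × A × Q)) : List A :=
  π.map (fun e => e.2.1)

/-- A finite path of the underlying graph: a sequence of consecutive edges. -/
def IsPath {A Q : Type*} (𝒜 : DyckAutomaton A Q) (π : List (Q × A × Q)) : Prop :=
  (∀ e ∈ π, e ∈ 𝒜.edges) ∧ π.Chain' (fun e f => e.2.2 = f.1)

/-- A finite path is admissible if for any factor `e · π₁ · f` of it with `e` a call
edge, `f` a return edge and the label of `π₁` a Dyck word, `(e,f)` is a matched pair. -/
def IsAdmissible {A Q : Type*} (P : PushdownAlphabet A) (𝒜 : DyckAutomaton A Q)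
    (π : List (Q × A × Q)) : Prop :=
  IsPath 𝒜 π ∧
  ∀ (π₀ : List (Q × A × Q)) (e : Q × A × Q) (π₁ : List (Q × A × Q)) (f : Q × A × Q)
    (π₂ : List (Q × A × Q)), π = π₀ ++ e :: π₁ ++ f :: π₂ →
    P.kind e.2.1 = LetterKind.call → P.kind f.2.1 = LetterKind.ret →
    IsDyck P (pathLabel π₁) → (e, f) ∈ 𝒜.matched

/-- The finite factor of a bi-infinite path starting at index `i`, of length `n`. -/
def pathSeg {A Q : Type*} (π : ℤ → Q × A × Q) (i : ℤ) (n : ℕ) : List (Q × A × Q) :=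
  (List.range n).map (fun k => π (i + (k : ℤ)))

/-- A bi-infinite path is admissible if it is a bi-infinite path of the graph all of
whose finite factors are admissible. -/
def BiAdmissible {A Q : Type*} (P : PushdownAlphabet A) (𝒜 : DyckAutomaton A Q)
    (π : ℤ → Q × A × Q) : Prop :=
  (∀ i : ℤ, π i ∈ 𝒜.edges) ∧ (∀ i : ℤ, (π i).2.2 = (π (i + 1)).1) ∧
  ∀ (i : ℤ) (n : ℕ), IsAdmissible P 𝒜 (pathSeg π i n)

/-- The sofic-Dyck shift presented by a Dyck automaton: the set of labels of
bi-infinite admissible paths. -/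
def presents {A Q : Type*} (P : PushdownAlphabet A) (𝒜 : DyckAutomaton A Q) :
    Set (ℤ → A) :=
  { x | ∃ π : ℤ → Q × A × Q, BiAdmissible P 𝒜 π ∧ ∀ i : ℤ, (π i).2.1 = x i }

/-- A sofic-Dyck shift over `A`: a set presented by some (finite, well-formed)
Dyck automaton. -/
def IsSoficDyck {A : Type*} (P : PushdownAlphabet A) (X : Set (ℤ → A)) : Prop :=
  ∃ (N : ℕ) (𝒜 : DyckAutomaton A (Fin N)), 𝒜.WellFormed P ∧ X = presents P 𝒜

/-- A finite path goes from `p` to `q` (an empty path goes from `p` to `p`). -/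
def GoesFromTo {A Q : Type*} (π : List (Q × A × Q)) (p q : Q) : Prop :=
  (∀ e ∈ π.head?, e.1 = p) ∧ (∀ e ∈ π.getLast?, e.2.2 = q) ∧ (π = [] → p = q)

/-- A finite path starts at state `p`. -/
def StartsAt {A Q : Type*} (π : List (Q × A × Q)) (p : Q) : Prop :=
  ∀ e ∈ π.head?, e.1 = p

/-- A visibly pushdown automaton over `A` with states `Q` and stack alphabet `Γ`
(with a distinguished bottom-of-stack symbol `bot`). -/
structure VPA (A : Type*) (Q : Type*) (Γ : Type*) where
  init : Set Q
  bot : Γ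
  push : Set (Q × A × Q × Γ)
  pop : Set (Q × A × Γ × Q)
  internal : Set (Q × A × Q)
  final : Set Q

/-- `VPA.Steps P V c w c'` : there is a run of the visibly pushdown automaton `V`
labeled by `w` from configuration `c` to configuration `c'`.  A configuration is a
pair of a state and a stack; stacks are represented by the list of their symbols
above the bottom symbol, with the top of the stack at the end of the list. -/
inductive VPA.Steps {A Q Γ : Type*} (P : PushdownAlphabet A) (V : VPA A Q Γ) :
    Q × List Γ → List A → Q × List Γ → Prop
  | refl (c : Q × List Γ) : VPA.Steps P V c [] c
  | call {p : Q} {σ : List Γ} {a : A} {q : Q} {γ : Γ} {w : List A} {c : Q × List Γ} :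
      P.kind a = LetterKind.call → (p, a, q, γ) ∈ V.push → γ ≠ V.bot →
      VPA.Steps P V (q, σ ++ [γ]) w c → VPA.Steps P V (p, σ) (a :: w) c
  | pop {p : Q} {σ : List Γ} {a : A} {γ : Γ} {q : Q} {w : List A} {c : Q × List Γ} :
      P.kind a = LetterKind.ret → (p, a, γ, q) ∈ V.pop → γ ≠ V.bot →
      VPA.Steps P V (q, σ) w c → VPA.Steps P V (p, σ ++ [γ]) (a :: w) c
  | popBot {p : Q} {a : A} {q : Q} {w : List A} {c : Q × List Γ} :
      P.kind a = LetterKind.ret → (p, a, V.bot, q) ∈ V.pop →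
      VPA.Steps P V (q, []) w c → VPA.Steps P V (p, []) (a :: w) c
  | internal {p : Q} {σ : List Γ} {a : A} {q : Q} {w : List A} {c : Q × List Γ} :
      P.kind a = LetterKind.intern → (p, a, q) ∈ V.internal →
      VPA.Steps P V (q, σ) w c → VPA.Steps P V (p, σ) (a :: w) c

/-- A word is accepted by a visibly pushdown automaton if it labels a run from an
initial state with empty stack to a final state. -/
def VPA.Accepts {A Q Γ : Type*} (P : PushdownAlphabet A) (V : VPA A Q Γ)
    (w : List A) : Prop :=
  ∃ (p q : Q) (σ : List Γ), p ∈ V.init ∧ q ∈ V.final ∧ VPA.Steps P V (p, []) w (q, σ)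

/-- A visibly pushdown language over `A`: the set of words accepted by some (finite)
visibly pushdown automaton over `A`. -/
def IsVPL {A : Type*} (P : PushdownAlphabet A) (L : Set (List A)) : Prop :=
  ∃ (nQ nΓ : ℕ) (V : VPA A (Fin nQ) (Fin (nΓ + 1))),
    L = { w | VPA.Accepts P V w }

/-- A language is factorial if it contains every factor of each of its words. -/
def FactorialLang {A : Type*} (L : Set (List A)) : Prop :=
  ∀ u v w : List A, u ++ v ++ w ∈ L → v ∈ L

/-- A language is extensible if every word of it extends on both sides by nonempty
words to a word of the language. -/
def ExtensibleLang {A : Type*} (L : Set (List A)) : Prop :=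
  ∀ u ∈ L, ∃ w z : List A, w ≠ [] ∧ z ≠ [] ∧ w ++ u ++ z ∈ L

/-- The bi-extensible subset of `L`: words of `L` extensible on both sides by
arbitrarily long words within `L`. -/
def BiExt {A : Type*} (L : Set (List A)) : Set (List A) :=
  { w | w ∈ L ∧ ∀ n : ℕ, ∃ u v : List A, n ≤ u.length ∧ n ≤ v.length ∧ u ++ w ++ v ∈ L }

/-- The set of blocks (finite factors) of a set of bi-infinite sequences. -/
def blocksOf {A : Type*} (X : Set (ℤ → A)) : Set (List A) :=
  { w | ∃ x ∈ X, IsFactorOf w x }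

end SD

namespace SD

section Words

variable {A : Type*} (P : PushdownAlphabet A)

@[simp] lemma callCount_nil : callCount P [] = 0 := rfl

@[simp] lemma retCount_nil : retCount P [] = 0 := rfl

lemma callCount_cons (a : A) (u : List A) :
    callCount P (a :: u) = callCount P u + if P.kind a = LetterKind.call then 1 else 0 := by
  simp [callCount, List.countP_cons]

lemma retCount_cons (a : A) (u : List A) :
    retCount P (a :: u) = retCount P u + if P.kind a = LetterKind.ret then 1 else 0 := by
  simp [retCount, List.countP_cons]

@[simp] lemma callCount_append (u v : List A) :
    callCount P (u ++ v) = callCount P u + callCount P v := List.countP_append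

@[simp] lemma retCount_append (u v : List A) :
    retCount P (u ++ v) = retCount P u + retCount P v := List.countP_append

@[simp] lemma callCount_reverse (u : List A) : callCount P u.reverse = callCount P u :=
  List.countP_reverse

@[simp] lemma retCount_reverse (u : List A) : retCount P u.reverse = retCount P u :=
  List.countP_reverse

variable {P}

lemma MatchedReturn.append {u v : List A} (hu : MatchedReturn P u) (hv : MatchedReturn P v) :
    MatchedReturn P (u ++ v) := by
  intro x y h
  rcases List.append_eq_append_iff.1 h with ⟨z, rfl, hz⟩ | ⟨z, hz, -⟩
  · have h₁ := hu u [] (by simp)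
    have h₂ := hv _ _ hz
    simp only [callCount_append, retCount_append]
    omega
  · exact hu _ _ hz

lemma MatchedCall.append {u v : List A} (hu : MatchedCall P u) (hv : MatchedCall P v) :
    MatchedCall P (u ++ v) := by
  intro x y h
  rcases List.append_eq_append_iff.1 h with ⟨z, -, hz⟩ | ⟨z, hz, rfl⟩
  · exact hv _ _ hz
  · have h₁ := hu _ _ hz
    have h₂ := hv [] v rfl
    simp only [callCount_append, retCount_append]
    omega

lemma MatchedReturn.of_append {u v : List A} (h : MatchedReturn P (u ++ v)) :
    MatchedReturn P u := by
  rintro x y rfl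
  exact h x (y ++ v) (by simp)

lemma IsDyck.append {u v : List A} (hu : IsDyck P u) (hv : IsDyck P v) : IsDyck P (u ++ v) :=
  ⟨hu.1.append hv.1, hu.2.append hv.2⟩

lemma isDyck_nil : IsDyck P [] := by
  constructor <;> intro v w h <;> simp_all

lemma isDyck_singleton {a : A} (ha : P.kind a = LetterKind.intern) : IsDyck P [a] := by
  constructor <;> intro v w h <;>
    rcases List.singleton_eq_append_iff.1 h with ⟨rfl, rfl⟩ | ⟨rfl, rfl⟩ <;>
    simp [callCount_cons, retCount_cons, ha]

lemma IsDyck.wrap {a b : A} {u : List A} (ha : P.kind a = LetterKind.call)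
    (hb : P.kind b = LetterKind.ret) (hu : IsDyck P u) : IsDyck P (a :: (u ++ [b])) := by
  have h₁ := hu.1 u [] (by simp)
  have h₂ := hu.2 [] u rfl
  constructor
  · intro v w h
    rcases List.cons_eq_append_iff.1 h with ⟨rfl, -⟩ | ⟨v, rfl, h'⟩
    · simp
    · rcases List.append_eq_append_iff.1 h' with ⟨z, rfl, hz⟩ | ⟨z, hz, -⟩
      · rcases List.singleton_eq_append_iff.1 hz with ⟨rfl, rfl⟩ | ⟨rfl, rfl⟩ <;>
        simp [callCount_cons, retCount_cons, ha, hb] <;> omega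
      · have := hu.1 _ _ hz
        simp [callCount_cons, retCount_cons, ha] at *
        omega
  · intro v w h
    rcases List.cons_eq_append_iff.1 h with ⟨rfl, rfl⟩ | ⟨v, rfl, h'⟩
    · simp [callCount_cons, retCount_cons, ha, hb]
      omega
    · rcases List.append_eq_append_iff.1 h' with ⟨z, rfl, hz⟩ | ⟨z, hz, rfl⟩
      · rcases List.singleton_eq_append_iff.1 hz with ⟨rfl, rfl⟩ | ⟨rfl, rfl⟩ <;>
        simp [callCount_cons, retCount_cons, hb]
      · have := hu.2 _ _ hz
        simp [callCount_cons, retCount_cons, hb] at *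
        omega

end Words

section Factors

variable {A : Type*}

lemma factorAt_eq_map (x : ℤ → A) (i : ℤ) (n : ℕ) :
    factorAt x i n = (List.range n).map fun k : ℕ => x (i + k) := by
  have : ∀ l : List ℕ, l.flatMap (fun k : ℕ => [(k : ℤ)]) = l.map fun k : ℕ => (k : ℤ) :=
    fun l => List.flatMap_pure_eq_map _ l
  simp [factorAt, this]

@[simp] lemma length_factorAt (x : ℤ → A) (i : ℤ) (n : ℕ) : (factorAt x i n).length = n := by
  simp [factorAt_eq_map]

lemma factorAt_add (x : ℤ → A) (i : ℤ) (m n : ℕ) :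
    factorAt x i (m + n) = factorAt x i m ++ factorAt x (i + m) n := by
  simp [factorAt_eq_map, List.range_add, add_assoc]

lemma isFactorOf_factorAt (x : ℤ → A) (i : ℤ) (n : ℕ) : IsFactorOf (factorAt x i n) x :=
  ⟨i, by simp⟩

lemma isFactorOf_of_infix {x : ℤ → A} {i : ℤ} {n : ℕ} {w : List A}
    (h : w <:+: factorAt x i n) : IsFactorOf w x := by
  obtain ⟨u, v, h⟩ := h
  obtain rfl : n = u.length + w.length + v.length := by
    simpa [add_assoc] using (congrArg List.length h).symm
  rw [factorAt_add, factorAt_add] at h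
  exact ⟨i + u.length, (List.append_inj (List.append_inj h (by simp)).1 (by simp)).2⟩

lemma factorAt_infix_factorAt (x : ℤ → A) {i j : ℤ} {m n : ℕ} (hij : j ≤ i)
    (hmn : i + m ≤ j + n) : factorAt x i m <:+: factorAt x j n := by
  obtain ⟨k, rfl⟩ := Int.le.dest hij
  obtain ⟨l, rfl⟩ : ∃ l, n = k + m + l := ⟨n - (k + m), by omega⟩
  rw [factorAt_add, factorAt_add]
  exact ⟨_, _, rfl⟩

lemma map_factorAt {B : Type*} (f : A → B) (x : ℤ → A) (i : ℤ) (n : ℕ) :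
    (factorAt x i n).map f = factorAt (fun k => f (x k)) i n := by
  simp [factorAt_eq_map]

lemma factorAt_congr {x y : ℤ → A} {i : ℤ} {n : ℕ}
    (h : ∀ k : ℕ, k < n → x (i + k) = y (i + k)) : factorAt x i n = factorAt y i n := by
  rw [factorAt_eq_map, factorAt_eq_map]
  exact List.map_congr_left fun k hk => h k (List.mem_range.1 hk)

end Factors

section Paths

variable {A Q : Type*} (P : PushdownAlphabet A) (𝒜 : DyckAutomaton A Q)

/-- The pending call edges of a path, innermost first. The path is given by its history, that is,
with its last edge first. -/
def pending : List (Q × A × Q) → List (Q × A × Q)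
  | [] => []
  | f :: π =>
    match P.kind f.2.1 with
    | LetterKind.call => f :: pending π
    | LetterKind.ret => (pending π).tail
    | LetterKind.intern => pending π

/-- Admissibility of a path ending in a given state, the path being given by its history
(last edge first). -/
def AdmissibleHistory : List (Q × A × Q) → Q → Prop
  | [], _ => True
  | f :: π, q => f ∈ 𝒜.edges ∧ f.2.2 = q ∧ AdmissibleHistory π f.1 ∧
      (P.kind f.2.1 = LetterKind.ret → ∀ e ∈ (pending P π).head?, (e, f) ∈ 𝒜.matched)

variable {P 𝒜}

lemma pending_append_of_matchedReturn (ρ τ : List (Q × A × Q))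
    (h : MatchedReturn P (pathLabel τ.reverse)) :
    ∃ μ, pending P (τ ++ ρ) = μ ++ pending P ρ ∧
      μ.length + retCount P (pathLabel τ) = callCount P (pathLabel τ) := by
  induction τ with
  | nil => exact ⟨[], by simp [pathLabel]⟩
  | cons f τ ih =>
    have hle := h _ [] (List.append_nil _).symm
    obtain ⟨μ, hμ, hlen⟩ := ih (by
      simp only [pathLabel, List.reverse_cons, List.map_append] at h ⊢
      exact h.of_append)
    simp only [pathLabel, List.map_reverse, retCount_reverse, callCount_reverse, List.map_cons,
      callCount_cons, retCount_cons] at hle hlen ⊢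
    rcases hk : P.kind f.2.1
    · exact ⟨f :: μ, by simp [pending, hk, hμ], by simp; omega⟩
    · simp only [hk, reduceCtorEq, if_true, if_false] at hle
      match μ, hμ, hlen with
      | [], _, hlen => simp at hlen; omega
      | g :: μ, hμ, hlen => exact ⟨μ, by simp [pending, hk, hμ], by simp at hlen ⊢; omega⟩
    · exact ⟨μ, by simp [pending, hk, hμ], by simpa using hlen⟩

lemma pending_of_isDyck {e : Q × A × Q} (τ ρ : List (Q × A × Q))
    (he : P.kind e.2.1 = LetterKind.call) (h : IsDyck P (pathLabel τ.reverse)) :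
    pending P (τ ++ e :: ρ) = e :: pending P ρ := by
  obtain ⟨μ, hμ, hlen⟩ := pending_append_of_matchedReturn (e :: ρ) τ h.1
  have hle := h.2 [] _ rfl
  simp only [pathLabel, List.map_reverse, retCount_reverse, callCount_reverse] at hle hlen
  obtain rfl : μ = [] := List.length_eq_zero_iff.1 (by omega)
  simpa [pending, he] using hμ

lemma exists_of_pending_eq_cons {e : Q × A × Q} {σ : List (Q × A × Q)} (π : List (Q × A × Q))
    (h : pending P π = e :: σ) :
    ∃ τ ρ, π = τ ++ e :: ρ ∧ P.kind e.2.1 = LetterKind.call ∧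
      IsDyck P (pathLabel τ.reverse) ∧ pending P ρ = σ := by
  induction hn : π.length using Nat.strong_induction_on generalizing π e σ with
  | _ n ih =>
    subst hn
    match π with
    | [] => simp [pending] at h
    | f :: π =>
      rcases hk : P.kind f.2.1
      · simp only [pending, hk, List.cons.injEq] at h
        obtain ⟨rfl, rfl⟩ := h
        exact ⟨[], π, rfl, hk, isDyck_nil, rfl⟩
      · simp only [pending, hk] at h
        obtain ⟨g, hg⟩ : ∃ g, pending P π = g :: e :: σ := by
          rcases hp : pending P π with _ | ⟨g, l⟩
          · simp [hp] at h
          · exact ⟨g, by rw [hp] at h; simpa using h⟩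
        obtain ⟨τ, ρ, rfl, hgc, hD, hρ⟩ := ih _ (by simp) π hg rfl
        obtain ⟨τ', ρ', rfl, hec, hD', hρ'⟩ := ih _ (by simp; omega) ρ hρ rfl
        refine ⟨f :: τ ++ g :: τ', ρ', by simp, hec, ?_, hρ'⟩
        have := hD'.append (hD.wrap hgc hk)
        simpa [pathLabel] using this
      · simp only [pending, hk] at h
        obtain ⟨τ, ρ, rfl, hec, hD, hρ⟩ := ih _ (by simp) π h rfl
        refine ⟨f :: τ, ρ, by simp, hec, ?_, hρ⟩
        have := hD.append (isDyck_singleton hk)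
        simpa [pathLabel] using this

lemma IsAdmissible.of_infix {π ρ : List (Q × A × Q)} (h : IsAdmissible P 𝒜 π) (hρ : ρ <:+: π) :
    IsAdmissible P 𝒜 ρ := by
  refine ⟨⟨fun e he => h.1.1 e (hρ.subset he), h.1.2.infix hρ⟩, ?_⟩
  obtain ⟨u, v, rfl⟩ := hρ
  rintro π₀ e π₁ f π₂ rfl
  exact h.2 (u ++ π₀) e π₁ f (π₂ ++ v) (by simp)

lemma AdmissibleHistory.of_append {τ ρ : List (Q × A × Q)} {q : Q}
    (h : AdmissibleHistory P 𝒜 (τ ++ ρ) q) : ∃ q', AdmissibleHistory P 𝒜 ρ q' := by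
  induction τ generalizing q with
  | nil => exact ⟨q, h⟩
  | cons f τ ih => exact ih h.2.2.1

lemma AdmissibleHistory.isPath {π : List (Q × A × Q)} {q : Q}
    (h : AdmissibleHistory P 𝒜 π q) : IsPath 𝒜 π.reverse ∧ ∀ f ∈ π.head?, f.2.2 = q := by
  induction π generalizing q with
  | nil => exact ⟨⟨by simp, List.isChain_nil⟩, by simp⟩
  | cons f π ih =>
    obtain ⟨hf, hq, hπ, -⟩ := h
    obtain ⟨⟨h₁, h₂⟩, h₃⟩ := ih hπ
    refine ⟨⟨?_, ?_⟩, by simpa using hq⟩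
    · simp only [List.mem_reverse, List.mem_cons, forall_eq_or_imp] at h₁ ⊢
      exact ⟨hf, h₁⟩
    · change List.IsChain _ _
      rw [List.reverse_cons, List.isChain_append]
      refine ⟨h₂, List.isChain_singleton _, ?_⟩
      simpa using h₃

lemma admissibleHistory_iff {π : List (Q × A × Q)} {q : Q} :
    AdmissibleHistory P 𝒜 π q ↔
      IsAdmissible P 𝒜 π.reverse ∧ ∀ f ∈ π.head?, f.2.2 = q := by
  constructor
  · intro h
    refine ⟨⟨h.isPath.1, ?_⟩, h.isPath.2⟩
    intro π₀ e π₁ f π₂ hdec he hf hD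
    obtain rfl : π = π₂.reverse ++ f :: (π₁.reverse ++ e :: π₀.reverse) := by
      rw [← List.reverse_reverse π, hdec]
      simp
    obtain ⟨q', h'⟩ := h.of_append
    refine h'.2.2.2 hf e ?_
    rw [pending_of_isDyck _ _ he (by simpa using hD)]
    simp
  · rintro ⟨h, hq⟩
    induction π generalizing q with
    | nil => trivial
    | cons f π ih =>
      refine ⟨h.1.1 f (by simp), by simpa using hq, ih (h.of_infix ?_) ?_, ?_⟩
      · rw [List.reverse_cons]
        exact (List.prefix_append _ _).isInfix
      · have : List.IsChain _ _ := h.1.2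
        rw [List.reverse_cons, List.isChain_append] at this
        simpa using this.2.2
      · intro hf e he
        obtain ⟨σ, hσ⟩ : ∃ σ, pending P π = e :: σ := by
          rcases hp : pending P π with _ | ⟨g, l⟩ <;> simp_all
        obtain ⟨τ, ρ, rfl, hec, hD, -⟩ := exists_of_pending_eq_cons π hσ
        exact h.2 ρ.reverse e τ.reverse f [] (by simp) hec hf hD

lemma pathSeg_eq_factorAt (π : ℤ → Q × A × Q) (i : ℤ) (n : ℕ) :
    pathSeg π i n = factorAt π i n := rfl

/-- By compactness, a sequence is presented by a finite Dyck automaton as soon as each of its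
factors labels a finite admissible path. -/
theorem mem_presents_iff [Finite A] [Finite Q] {x : ℤ → A} :
    x ∈ presents P 𝒜 ↔
      ∀ i n, ∃ π, IsAdmissible P 𝒜 π ∧ pathLabel π = factorAt x i n := by
  constructor
  · rintro ⟨π, hπ, hx⟩ i n
    refine ⟨pathSeg π i n, hπ.2.2 i n, ?_⟩
    rw [pathSeg_eq_factorAt, pathLabel, map_factorAt]
    exact congrArg (fun y => factorAt y i n) (funext hx)
  · intro h
    have key : ∀ n : ℕ, ∃ π : ℤ → Q × A × Q,
        IsAdmissible P 𝒜 (factorAt π (-n) (2 * n + 1)) ∧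
        ∀ i : ℤ, -n ≤ i → i ≤ n → (π i).2.1 = x i := by
      intro n
      obtain ⟨L, hL, hlab⟩ := h (-n) (2 * n + 1)
      have hlen : L.length = 2 * n + 1 := by
        simpa [pathLabel] using congrArg List.length hlab
      have hne : L ≠ [] := by
        rintro rfl
        simp at hlen
      have hseg : factorAt (fun i => L.getD (i + n).toNat (L.head hne)) (-n) (2 * n + 1) = L := by
        refine List.ext_getElem (by simp [hlen]) fun k hk hk' => ?_
        simp [factorAt_eq_map, hk']
      refine ⟨_, hseg.symm ▸ hL, fun i hi hi' => ?_⟩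
      have hk : (i + n).toNat < L.length := by omega
      have := congrArg (fun l => l[(i + n).toNat]?) hlab
      simp only [pathLabel, factorAt_eq_map, List.getElem?_map, List.getElem?_eq_getElem hk,
        List.getElem?_range (hlen ▸ hk), Option.map_some, Option.some.injEq] at this
      rw [List.getD_eq_getElem _ _ hk, this]
      congr 1
      omega
    choose p hp hpx using key
    have hlim : ∀ i : ℤ, ∃ e, ∀ᶠ n in (Filter.hyperfilter ℕ : Filter ℕ), p n i = e := by
      intro i
      obtain ⟨e, he⟩ := Ultrafilter.eq_pure_of_finite ((Filter.hyperfilter ℕ).map fun n => p n i)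
      refine ⟨e, ?_⟩
      have : ({e} : Set (Q × A × Q)) ∈ (Filter.hyperfilter ℕ).map fun n => p n i := by
        rw [he]
        exact Set.mem_singleton e
      exact this
    choose π hπ using hlim
    have hlarge : ∀ N : ℕ, ∀ᶠ n in (Filter.hyperfilter ℕ : Filter ℕ), N ≤ n := fun N =>
      Nat.hyperfilter_le_atTop (Filter.eventually_ge_atTop N)
    have hadm : ∀ (i : ℤ) (m : ℕ), IsAdmissible P 𝒜 (factorAt π i m) := by
      intro i m
      have hall : ∀ᶠ n in (Filter.hyperfilter ℕ : Filter ℕ), ∀ k ∈ Finset.range m,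
          p n (i + k) = π (i + k) :=
        (Filter.eventually_all_finset _).2 fun k _ => hπ _
      obtain ⟨n, hn, hN⟩ := (hall.and (hlarge (i.natAbs + m))).exists
      rw [← factorAt_congr fun k hk => hn k (Finset.mem_range.2 hk)]
      exact (hp n).of_infix (factorAt_infix_factorAt _ (by omega) (by push_cast; omega))
    refine ⟨π, ⟨fun i => ?_, fun i => ?_, hadm⟩, fun i => ?_⟩
    · exact (hadm i 1).1.1 _ (by simp [factorAt_eq_map])
    · have : List.IsChain _ _ := (hadm i 2).1.2
      simpa [factorAt_eq_map, List.range_succ] using this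
    · obtain ⟨n, hn, hN⟩ := ((hπ i).and (hlarge i.natAbs)).exists
      rw [← hn]
      exact hpx n i (by omega) (by omega)

end Paths

section Transport

variable {A Q R : Type*} {P : PushdownAlphabet A}

/-- The action on edges of a renaming of the states. -/
def mapEdge (e : R → Q) (x : R × A × R) : Q × A × Q := (e x.1, x.2.1, e x.2.2)

/-- The Dyck automaton obtained by pulling back along a map of states. -/
def DyckAutomaton.comap (𝒜 : DyckAutomaton A Q) (e : R → Q) : DyckAutomaton A R where
  edges := {x | mapEdge e x ∈ 𝒜.edges}
  matched := {x | (mapEdge e x.1, mapEdge e x.2) ∈ 𝒜.matched}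

@[simp] lemma pathLabel_map_mapEdge (e : R → Q) (π : List (R × A × R)) :
    pathLabel (π.map (mapEdge e)) = pathLabel π := by
  simp [pathLabel, mapEdge]

lemma pending_map_mapEdge (e : R → Q) (π : List (R × A × R)) :
    pending P (π.map (mapEdge e)) = (pending P π).map (mapEdge e) := by
  induction π with
  | nil => rfl
  | cons f π ih => rcases hk : P.kind f.2.1 <;> simp [pending, mapEdge, hk, ih]

lemma admissibleHistory_comap (𝒜 : DyckAutomaton A Q) (e : R ≃ Q) (π : List (R × A × R)) (q : R) :
    AdmissibleHistory P (𝒜.comap e) π q ↔ AdmissibleHistory P 𝒜 (π.map (mapEdge e)) (e q) := by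
  induction π generalizing q with
  | nil => rfl
  | cons f π ih =>
    simp only [AdmissibleHistory, List.map_cons, ih, pending_map_mapEdge]
    rcases pending P π with _ | ⟨g, σ⟩ <;> simp [DyckAutomaton.comap, mapEdge]

lemma isAdmissible_reverse_iff {𝒜 : DyckAutomaton A Q} {π : List (Q × A × Q)} :
    IsAdmissible P 𝒜 π.reverse ↔ π = [] ∨ ∃ q, AdmissibleHistory P 𝒜 π q := by
  simp only [admissibleHistory_iff]
  rcases π with _ | ⟨f, π⟩
  · refine ⟨fun _ => Or.inl rfl, fun _ => ⟨⟨by simp, List.isChain_nil⟩, ?_⟩⟩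
    intro π₀ e π₁ f π₂ h
    simp at h
  · simp

lemma exists_isAdmissible_iff {𝒜 : DyckAutomaton A Q} {w : List A} :
    (∃ π, IsAdmissible P 𝒜 π ∧ pathLabel π = w) ↔
      w = [] ∨ ∃ π q, AdmissibleHistory P 𝒜 π q ∧ pathLabel π = w.reverse := by
  constructor
  · rintro ⟨π, h, rfl⟩
    rw [← List.reverse_reverse π, isAdmissible_reverse_iff] at h
    rcases h with h | ⟨q, h⟩
    · exact Or.inl (by simpa [pathLabel] using h)
    · exact Or.inr ⟨_, q, h, by simp [pathLabel]⟩
  · rintro (rfl | ⟨π, q, h, hw⟩)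
    · exact ⟨[], by simpa using (isAdmissible_reverse_iff (𝒜 := 𝒜) (π := [])).2 (Or.inl rfl), rfl⟩
    · exact ⟨π.reverse, isAdmissible_reverse_iff.2 (Or.inr ⟨q, h⟩), by
        simpa [pathLabel] using congrArg List.reverse hw⟩

/-- The states of a Dyck automaton may be taken in any finite type. -/
lemma isSoficDyck_presents [Finite A] [Finite Q] {𝒜 : DyckAutomaton A Q}
    (h : 𝒜.WellFormed P) : IsSoficDyck P (presents P 𝒜) := by
  obtain ⟨N, ⟨e⟩⟩ := Finite.exists_equiv_fin Q
  refine ⟨N, 𝒜.comap e.symm, fun x y hxy => h _ _ hxy, ?_⟩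
  ext x
  simp only [mem_presents_iff, exists_isAdmissible_iff, admissibleHistory_comap]
  refine forall₂_congr fun i n => or_congr_right ⟨?_, ?_⟩
  · rintro ⟨π, q, hπ, hlab⟩
    refine ⟨π.map (mapEdge e), e q, ?_, by simpa using hlab⟩
    have : (mapEdge e.symm ∘ mapEdge e : Q × A × Q → Q × A × Q) = id := by
      ext y <;> simp [mapEdge]
    simpa [this] using hπ
  · rintro ⟨π, q, hπ, hlab⟩
    exact ⟨π.map (mapEdge e.symm), e.symm q, hπ, by simpa using hlab⟩

end Transport

section Machines

variable {A Q Γ S : Type*}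

/-- A nondeterministic visibly pushdown machine, with transition relations kept apart according to
whether they pop a symbol or read the bottom of the stack. -/
structure NMachine (A Q Γ : Type*) where
  start : Q → Prop
  push : Q → A → Q → Γ → Prop
  pop : Q → A → Γ → Q → Prop
  bot : Q → A → Q → Prop
  int : Q → A → Q → Prop

/-- One step of a nondeterministic machine; stacks have their top first. -/
def NMachine.Step (P : PushdownAlphabet A) (N : NMachine A Q Γ) (p : Q) (σ : List Γ) (a : A)
    (q : Q) (τ : List Γ) : Prop :=
  match P.kind a with
  | LetterKind.call => ∃ γ, N.push p a q γ ∧ τ = γ :: σ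
  | LetterKind.ret => (∃ γ, N.pop p a γ q ∧ σ = γ :: τ) ∨ (N.bot p a q ∧ σ = [] ∧ τ = [])
  | LetterKind.intern => N.int p a q ∧ τ = σ

lemma NMachine.Step.of_push {P : PushdownAlphabet A} {N : NMachine A Q Γ} {p q : Q} {σ : List Γ}
    {a : A} {γ : Γ} (hk : P.kind a = LetterKind.call) (h : N.push p a q γ) :
    N.Step P p σ a q (γ :: σ) := by
  simp only [NMachine.Step, hk]
  exact ⟨γ, h, rfl⟩

lemma NMachine.Step.of_pop {P : PushdownAlphabet A} {N : NMachine A Q Γ} {p q : Q} {σ : List Γ}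
    {a : A} {γ : Γ} (hk : P.kind a = LetterKind.ret) (h : N.pop p a γ q) :
    N.Step P p (γ :: σ) a q σ := by
  simp only [NMachine.Step, hk]
  exact Or.inl ⟨γ, h, rfl⟩

lemma NMachine.Step.of_bot {P : PushdownAlphabet A} {N : NMachine A Q Γ} {p q : Q} {a : A}
    (hk : P.kind a = LetterKind.ret) (h : N.bot p a q) : N.Step P p [] a q [] := by
  simp only [NMachine.Step, hk]
  exact Or.inr ⟨h, trivial, trivial⟩

lemma NMachine.Step.of_int {P : PushdownAlphabet A} {N : NMachine A Q Γ} {p q : Q} {σ : List Γ}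
    {a : A} (hk : P.kind a = LetterKind.intern) (h : N.int p a q) : N.Step P p σ a q σ := by
  simp only [NMachine.Step, hk]
  exact ⟨h, trivial⟩

/-- The configurations reachable by reading a word, given by its history (last letter first). -/
def NMachine.Reach (P : PushdownAlphabet A) (N : NMachine A Q Γ) : List A → Q → List Γ → Prop
  | [], q, σ => N.start q ∧ σ = []
  | a :: h, q, τ => ∃ p σ, N.Reach P h p σ ∧ N.Step P p σ a q τ

/-- A deterministic visibly pushdown machine, which pushes its state and the letter read. -/
structure DMachine (A S : Type*) where
  start : S
  call : S → A → S
  int : S → A → S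
  ret : S → A → S → A → S
  bot : S → A → S

/-- One step of a deterministic machine; stacks have their top first. -/
def DMachine.step (P : PushdownAlphabet A) (D : DMachine A S) (a : A) (c : S × List (S × A)) :
    S × List (S × A) :=
  match P.kind a with
  | LetterKind.call => (D.call c.1 a, (c.1, a) :: c.2)
  | LetterKind.ret =>
    match c.2 with
    | [] => (D.bot c.1 a, [])
    | t :: σ => (D.ret t.1 t.2 c.1 a, σ)
  | LetterKind.intern => (D.int c.1 a, c.2)

/-- The configuration reached by reading a word, given by its history (last letter first). -/
def DMachine.run (P : PushdownAlphabet A) (D : DMachine A S) (h : List A) : S × List (S × A) :=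
  h.foldr (D.step P) (D.start, [])

@[simp] lemma DMachine.run_cons (P : PushdownAlphabet A) (D : DMachine A S) (a : A) (h : List A) :
    D.run P (a :: h) = D.step P a (D.run P h) := rfl

/-- The summary machine: its state is the set of pairs `(p, q)` where `q` is a reachable state
and `p` the state just after the last pending call of some run leading to `q`. -/
def NMachine.summary (N : NMachine A Q Γ) : DMachine A (Set (Q × Q)) where
  start := {x | N.start x.1 ∧ x.1 = x.2}
  call T a := {x | x.1 = x.2 ∧ ∃ p q γ, (p, q) ∈ T ∧ N.push q a x.1 γ}
  int T a := {x | ∃ q, (x.1, q) ∈ T ∧ N.int q a x.2}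
  ret T a U b := {x | ∃ r p q γ, (x.1, r) ∈ T ∧ N.push r a p γ ∧ (p, q) ∈ U ∧ N.pop q b γ x.2}
  bot T b := {x | ∃ q, (x.1, q) ∈ T ∧ N.bot q b x.2}

/-- Compatibility of a stack of summaries with a stack of the original machine, `p` being the
state just after the push of the top symbol. -/
def NMachine.Compat (N : NMachine A Q Γ) : List (Set (Q × Q) × A) → Q → List Γ → Prop
  | [], _, [] => True
  | t :: S, p, γ :: σ => ∃ p' r, (p', r) ∈ t.1 ∧ N.push r t.2 p γ ∧ N.Compat S p' σ
  | _, _, _ => False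

/-- Every pair of every summary extends to a compatible stack. -/
def NMachine.Live (N : NMachine A Q Γ) : Set (Q × Q) → List (Set (Q × Q) × A) → Prop
  | _, [] => True
  | T, t :: S => (∀ x ∈ T, ∃ p' r γ, (p', r) ∈ t.1 ∧ N.push r t.2 x.1 γ) ∧ N.Live t.1 S

variable (P : PushdownAlphabet A)

lemma NMachine.reach_iff_summary (N : NMachine A Q Γ) (h : List A) (q : Q) (σ : List Γ) :
    N.Reach P h q σ ↔ ∃ p, (p, q) ∈ (N.summary.run P h).1 ∧
      N.Compat (N.summary.run P h).2 p σ := by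
  induction h generalizing q σ with
  | nil =>
    rcases σ with _ | ⟨γ, σ⟩ <;>
      simp [NMachine.Reach, DMachine.run, NMachine.summary, NMachine.Compat]
  | cons a h ih =>
    simp only [NMachine.Reach, ih, DMachine.run_cons]
    generalize N.summary.run P h = c
    obtain ⟨T, S⟩ := c
    rcases hk : P.kind a
    · simp only [NMachine.Step, DMachine.step, hk]
      constructor
      · rintro ⟨p, τ, ⟨p', hT, hC⟩, γ, hpush, rfl⟩
        exact ⟨q, ⟨rfl, p', p, γ, hT, hpush⟩, p', p, hT, hpush, hC⟩
      · rintro ⟨p, ⟨hp, -⟩, hC⟩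
        obtain rfl : p = q := hp
        match σ, hC with
        | γ :: σ, ⟨p', r, hT, hpush, hC⟩ => exact ⟨r, σ, ⟨p', hT, hC⟩, γ, hpush, rfl⟩
    · simp only [NMachine.Step, DMachine.step, hk]
      match S with
      | [] =>
        constructor
        · rintro ⟨p, τ, ⟨p', hT, hC⟩, ⟨γ, -, rfl⟩ | ⟨hbot, rfl, rfl⟩⟩
          · exact hC.elim
          · exact ⟨p', ⟨p, hT, hbot⟩, trivial⟩
        · rintro ⟨p, ⟨r, hT, hbot⟩, hC⟩
          match σ, hC with
          | [], _ => exact ⟨r, [], ⟨p, hT, trivial⟩, Or.inr ⟨hbot, rfl, rfl⟩⟩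
      | t :: S =>
        constructor
        · rintro ⟨p, τ, ⟨p', hT, hC⟩, ⟨γ, hpop, rfl⟩ | ⟨-, rfl, -⟩⟩
          · obtain ⟨p'', r, ht, hpush, hC⟩ := hC
            exact ⟨p'', ⟨r, p', p, γ, ht, hpush, hT, hpop⟩, hC⟩
          · exact hC.elim
        · rintro ⟨p, ⟨r, p', q', γ, ht, hpush, hT, hpop⟩, hC⟩
          exact ⟨q', γ :: σ, ⟨p', hT, p, r, ht, hpush, hC⟩, Or.inl ⟨γ, hpop, rfl⟩⟩
    · simp only [NMachine.Step, DMachine.step, hk]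
      constructor
      · rintro ⟨p, τ, ⟨p', hT, hC⟩, hint, rfl⟩
        exact ⟨p', ⟨p, hT, hint⟩, hC⟩
      · rintro ⟨p, ⟨r, hT, hint⟩, hC⟩
        exact ⟨r, σ, ⟨p, hT, hC⟩, hint, rfl⟩

lemma NMachine.live_summary (N : NMachine A Q Γ) (h : List A) :
    N.Live (N.summary.run P h).1 (N.summary.run P h).2 := by
  induction h with
  | nil => trivial
  | cons a h ih =>
    rw [DMachine.run_cons]
    generalize N.summary.run P h = c at ih
    obtain ⟨T, S⟩ := c
    rcases hk : P.kind a
    · simp only [DMachine.step, hk]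
      refine ⟨?_, ih⟩
      rintro ⟨s, s'⟩ ⟨-, p, q, γ, hT, hpush⟩
      exact ⟨p, q, γ, hT, hpush⟩
    · simp only [DMachine.step, hk]
      match S, ih with
      | [], _ => trivial
      | [t], _ => trivial
      | t :: t' :: S, ⟨_, h₂, h₃⟩ =>
        refine ⟨?_, h₃⟩
        rintro ⟨p, q⟩ ⟨r, -, -, -, ht, -⟩
        exact h₂ (p, r) ht
    · simp only [DMachine.step, hk]
      match S, ih with
      | [], _ => trivial
      | t :: S, ⟨h₁, h₂⟩ =>
        refine ⟨?_, h₂⟩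
        rintro ⟨p, q⟩ ⟨r, hr, -⟩
        exact h₁ (p, r) hr

lemma NMachine.Live.exists_compat {N : NMachine A Q Γ} {T : Set (Q × Q)}
    {S : List (Set (Q × Q) × A)} (h : N.Live T S) {p q : Q} (hp : (p, q) ∈ T) :
    ∃ σ, N.Compat S p σ := by
  induction S generalizing T p q with
  | nil => exact ⟨[], trivial⟩
  | cons t S ih =>
    obtain ⟨p', r, γ, ht, hpush⟩ := h.1 _ hp
    obtain ⟨σ, hσ⟩ := ih h.2 ht
    exact ⟨γ :: σ, p', r, ht, hpush, hσ⟩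

/-- The summary machine computes the set of reachable states. -/
theorem NMachine.exists_reach_iff (N : NMachine A Q Γ) (h : List A) (q : Q) :
    (∃ σ, N.Reach P h q σ) ↔ ∃ p, (p, q) ∈ (N.summary.run P h).1 := by
  simp only [N.reach_iff_summary]
  exact ⟨fun ⟨_, p, hp, _⟩ => ⟨p, hp⟩, fun ⟨p, hp⟩ =>
    let ⟨σ, hσ⟩ := (N.live_summary P h).exists_compat hp
    ⟨σ, p, hp, hσ⟩⟩

end Machines

section Languages

variable {A Q Γ S : Type*} (P : PushdownAlphabet A)

/-- The nondeterministic machine underlying a visibly pushdown automaton. -/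
def VPA.toNMachine (V : VPA A Q Γ) : NMachine A Q Γ where
  start q := q ∈ V.init
  push p a q γ := (p, a, q, γ) ∈ V.push ∧ γ ≠ V.bot
  pop p a γ q := (p, a, γ, q) ∈ V.pop ∧ γ ≠ V.bot
  bot p a q := (p, a, V.bot, q) ∈ V.pop
  int p a q := (p, a, q) ∈ V.internal

variable {P}

lemma VPA.steps_nil_iff {V : VPA A Q Γ} {c c' : Q × List Γ} :
    VPA.Steps P V c [] c' ↔ c = c' := by
  constructor
  · rintro ⟨⟩
    rfl
  · rintro rfl
    exact .refl _

lemma VPA.steps_cons_iff {V : VPA A Q Γ} {p : Q} {σ : List Γ} {a : A} {w : List A}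
    {c : Q × List Γ} :
    VPA.Steps P V (p, σ) (a :: w) c ↔
      ∃ q τ, V.toNMachine.Step P p σ.reverse a q τ.reverse ∧ VPA.Steps P V (q, τ) w c := by
  constructor
  · intro h
    cases h with
    | call hk hpush hγ h =>
      exact ⟨_, _, by simp only [NMachine.Step, hk]; exact ⟨_, ⟨hpush, hγ⟩, by simp⟩, h⟩
    | pop hk hpop hγ h =>
      exact ⟨_, _, by simp only [NMachine.Step, hk]; exact Or.inl ⟨_, ⟨hpop, hγ⟩, by simp⟩, h⟩
    | popBot hk hpop h =>
      exact ⟨_, _, by simp only [NMachine.Step, hk]; exact Or.inr ⟨hpop, rfl, rfl⟩, h⟩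
    | internal hk hint h =>
      exact ⟨_, _, by simp only [NMachine.Step, hk]; exact ⟨hint, trivial⟩, h⟩
  · rintro ⟨q, τ, hs, h⟩
    rcases hk : P.kind a <;> simp only [NMachine.Step, hk] at hs
    · obtain ⟨γ, ⟨hpush, hγ⟩, hτ⟩ := hs
      obtain rfl : τ = σ ++ [γ] := by simpa using congrArg List.reverse hτ
      exact .call hk hpush hγ h
    · rcases hs with ⟨γ, ⟨hpop, hγ⟩, hσ⟩ | ⟨hpop, hσ, hτ⟩
      · obtain rfl : σ = τ ++ [γ] := by simpa using congrArg List.reverse hσ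
        exact .pop hk hpop hγ h
      · obtain rfl : σ = [] := by simpa using hσ
        obtain rfl : τ = [] := by simpa using hτ
        exact .popBot hk hpop h
    · obtain ⟨hint, hτ⟩ := hs
      obtain rfl : τ = σ := by simpa using hτ
      exact .internal hk hint h

lemma VPA.steps_append_singleton_iff {V : VPA A Q Γ} {p q : Q} {σ τ : List Γ} {a : A}
    {w : List A} :
    VPA.Steps P V (p, σ) (w ++ [a]) (q, τ) ↔
      ∃ r ρ, VPA.Steps P V (p, σ) w (r, ρ) ∧
        V.toNMachine.Step P r ρ.reverse a q τ.reverse := by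
  induction w generalizing p σ with
  | nil =>
    simp only [List.nil_append, VPA.steps_cons_iff, VPA.steps_nil_iff, Prod.mk.injEq]
    constructor
    · rintro ⟨_, _, h, rfl, rfl⟩
      exact ⟨p, σ, ⟨rfl, rfl⟩, h⟩
    · rintro ⟨_, _, ⟨rfl, rfl⟩, h⟩
      exact ⟨q, τ, h, rfl, rfl⟩
  | cons b w ih =>
    simp only [List.cons_append, VPA.steps_cons_iff, ih]
    constructor
    · rintro ⟨p', σ', h, r, ρ, hs, hr⟩
      exact ⟨r, ρ, ⟨p', σ', h, hs⟩, hr⟩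
    · rintro ⟨r, ρ, ⟨p', σ', h, hs⟩, hr⟩
      exact ⟨p', σ', h, r, ρ, hs, hr⟩

lemma VPA.reach_iff {V : VPA A Q Γ} {h : List A} {q : Q} {σ : List Γ} :
    V.toNMachine.Reach P h q σ ↔
      ∃ p ∈ V.init, VPA.Steps P V (p, []) h.reverse (q, σ.reverse) := by
  induction h generalizing q σ with
  | nil =>
    simp only [NMachine.Reach, List.reverse_nil, VPA.steps_nil_iff, Prod.mk.injEq]
    constructor
    · rintro ⟨hq, rfl⟩
      exact ⟨q, hq, rfl, rfl⟩
    · rintro ⟨_, hq, rfl, hσ⟩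
      exact ⟨hq, by simpa using hσ.symm⟩
  | cons a h ih =>
    simp only [NMachine.Reach, List.reverse_cons, VPA.steps_append_singleton_iff, ih,
      List.reverse_reverse]
    constructor
    · rintro ⟨r, ρ, ⟨p, hp, hr⟩, hs⟩
      exact ⟨p, hp, r, ρ.reverse, hr, by simpa using hs⟩
    · rintro ⟨p, hp, r, ρ, hr, hs⟩
      exact ⟨r, ρ.reverse, ⟨p, hp, by simpa using hr⟩, hs⟩

lemma VPA.accepts_iff {V : VPA A Q Γ} {w : List A} :
    VPA.Accepts P V w ↔ ∃ q ∈ V.final, ∃ σ, V.toNMachine.Reach P w.reverse q σ := by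
  simp only [VPA.Accepts, VPA.reach_iff, List.reverse_reverse]
  constructor
  · rintro ⟨p, q, σ, hp, hq, h⟩
    exact ⟨q, hq, σ.reverse, p, hp, by simpa using h⟩
  · rintro ⟨q, hq, σ, p, hp, h⟩
    exact ⟨p, q, _, hp, hq, h⟩

/-- A deterministic machine as a visibly pushdown automaton, with states and stack symbols
renamed; `none` is the bottom symbol. -/
def DMachine.toVPA (D : DMachine A S) (e : S ≃ Q) (g : Option (S × A) ≃ Γ) (acc : Set S) :
    VPA A Q Γ where
  init := {e D.start}
  bot := g none
  push := {x | x.2.2.1 = e (D.call (e.symm x.1) x.2.1) ∧ x.2.2.2 = g (some (e.symm x.1, x.2.1))}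
  pop := {x | x.2.2.2 = match g.symm x.2.2.1 with
    | none => e (D.bot (e.symm x.1) x.2.1)
    | some t => e (D.ret t.1 t.2 (e.symm x.1) x.2.1)}
  internal := {x | x.2.2 = e (D.int (e.symm x.1) x.2.1)}
  final := {x | e.symm x ∈ acc}

lemma DMachine.reach_toVPA_iff (D : DMachine A S) (e : S ≃ Q) (g : Option (S × A) ≃ Γ)
    (acc : Set S) (h : List A) (q : Q) (σ : List Γ) :
    (D.toVPA e g acc).toNMachine.Reach P h q σ ↔
      q = e (D.run P h).1 ∧ σ = (D.run P h).2.map fun t => g (some t) := by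
  induction h generalizing q σ with
  | nil => simp [NMachine.Reach, DMachine.run, DMachine.toVPA, VPA.toNMachine]
  | cons a h ih =>
    simp only [NMachine.Reach, ih, DMachine.run_cons]
    generalize D.run P h = c
    obtain ⟨s, st⟩ := c
    rcases hk : P.kind a
    · simp only [NMachine.Step, DMachine.step, hk, DMachine.toVPA, VPA.toNMachine]
      constructor
      · rintro ⟨p, τ, ⟨rfl, rfl⟩, γ, ⟨⟨h₁, h₂⟩, -⟩, rfl⟩
        simp_all
      · rintro ⟨rfl, rfl⟩
        exact ⟨_, _, ⟨rfl, rfl⟩, g (some (s, a)), by simp, rfl⟩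
    · simp only [NMachine.Step, DMachine.step, hk, DMachine.toVPA, VPA.toNMachine]
      rcases st with _ | ⟨t, st⟩
      · constructor
        · rintro ⟨p, τ, ⟨rfl, rfl⟩, ⟨γ, -, h⟩ | ⟨hbot, -, rfl⟩⟩
          · simp at h
          · simpa using hbot
        · rintro ⟨rfl, rfl⟩
          exact ⟨_, _, ⟨rfl, rfl⟩, Or.inr (by simp)⟩
      · constructor
        · rintro ⟨p, τ, ⟨rfl, rfl⟩, ⟨γ, ⟨hpop, -⟩, h⟩ | ⟨-, h, -⟩⟩
          · simp only [List.map_cons, List.cons.injEq] at h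
            obtain ⟨rfl, rfl⟩ := h
            simpa using hpop
          · simp at h
        · rintro ⟨rfl, rfl⟩
          exact ⟨_, _, ⟨rfl, rfl⟩, Or.inl ⟨g (some t), by simp, rfl⟩⟩
    · simp only [NMachine.Step, DMachine.step, hk, DMachine.toVPA, VPA.toNMachine]
      constructor
      · rintro ⟨p, τ, ⟨rfl, rfl⟩, hint, rfl⟩
        simpa using hint
      · rintro ⟨rfl, rfl⟩
        exact ⟨_, _, ⟨rfl, rfl⟩, by simp, rfl⟩

/-- Languages recognized by finite deterministic machines are visibly pushdown languages. -/
theorem DMachine.isVPL [Finite A] [Finite S] (D : DMachine A S) (acc : Set S) :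
    IsVPL P {w | (D.run P w.reverse).1 ∈ acc} := by
  obtain ⟨n, ⟨e⟩⟩ := Finite.exists_equiv_fin S
  have hcard : Nat.card (Option (S × A)) = Nat.card (S × A) + 1 := Finite.card_option
  refine ⟨n, Nat.card (S × A), D.toVPA e (Finite.equivFinOfCardEq hcard) acc, ?_⟩
  ext w
  simp only [Set.mem_ofPred_eq, VPA.accepts_iff, DMachine.reach_toVPA_iff]
  simp [DMachine.toVPA]

end Languages

section Complement

variable {A Q : Type*} {P : PushdownAlphabet A}

/-- The machine whose runs are the admissible paths of a Dyck automaton; it pushes the call edges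
it follows. -/
def DyckAutomaton.toNMachine (𝒜 : DyckAutomaton A Q) : NMachine A Q (Q × A × Q) where
  start _ := True
  push p a q e := (p, a, q) ∈ 𝒜.edges ∧ e = (p, a, q)
  pop p a e q := (p, a, q) ∈ 𝒜.edges ∧ (e, (p, a, q)) ∈ 𝒜.matched
  bot p a q := (p, a, q) ∈ 𝒜.edges
  int p a q := (p, a, q) ∈ 𝒜.edges

lemma DyckAutomaton.reach_iff (𝒜 : DyckAutomaton A Q) (h : List A) (q : Q)
    (σ : List (Q × A × Q)) :
    𝒜.toNMachine.Reach P h q σ ↔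
      ∃ π, AdmissibleHistory P 𝒜 π q ∧ pathLabel π = h ∧ pending P π = σ := by
  induction h generalizing q σ with
  | nil =>
    constructor
    · rintro ⟨-, rfl⟩
      exact ⟨[], trivial, rfl, rfl⟩
    · rintro ⟨π, -, hπ, rfl⟩
      obtain rfl : π = [] := by simpa [pathLabel] using hπ
      exact ⟨trivial, rfl⟩
  | cons a h ih =>
    simp only [NMachine.Reach, ih]
    constructor
    · rintro ⟨p, τ, ⟨π, hπ, rfl, rfl⟩, hs⟩
      refine ⟨(p, a, q) :: π, ?_⟩
      rcases hk : P.kind a <;>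
        simp only [NMachine.Step, hk, DyckAutomaton.toNMachine] at hs
      · obtain ⟨e, ⟨he, rfl⟩, rfl⟩ := hs
        exact ⟨⟨he, rfl, hπ, by simp [hk]⟩, rfl, by simp [pending, hk]⟩
      · rcases hs with ⟨e, ⟨he, hm⟩, hp⟩ | ⟨he, hp, rfl⟩
        · exact ⟨⟨he, rfl, hπ, by simp [hp, hm]⟩, rfl, by simp [pending, hk, hp]⟩
        · exact ⟨⟨he, rfl, hπ, by simp [hp]⟩, rfl, by simp [pending, hk, hp]⟩
      · obtain ⟨he, rfl⟩ := hs
        exact ⟨⟨he, rfl, hπ, by simp [hk]⟩, rfl, by simp [pending, hk]⟩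
    · rintro ⟨_ | ⟨⟨p, b, q'⟩, π⟩, hπ, hlab, rfl⟩
      · simp [pathLabel] at hlab
      obtain ⟨rfl, rfl⟩ : b = a ∧ pathLabel π = h := by simpa [pathLabel] using hlab
      obtain ⟨he, rfl, hπ, hm⟩ := hπ
      refine ⟨p, _, ⟨π, hπ, rfl, rfl⟩, ?_⟩
      rcases hk : P.kind b <;>
        simp only [NMachine.Step, hk, DyckAutomaton.toNMachine, pending]
      · exact ⟨_, ⟨he, rfl⟩, rfl⟩
      · rcases hp : pending P π with _ | ⟨e, σ⟩
        · exact Or.inr ⟨he, rfl, rfl⟩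
        · exact Or.inl ⟨e, ⟨he, hm hk e (by simp [hp])⟩, rfl⟩
      · exact ⟨he, trivial⟩

/-- A sofic-Dyck shift is defined by a visibly pushdown language of forbidden factors. -/
theorem IsSoficDyck.exists_isVPL [Finite A] {X : Set (ℤ → A)} (hX : IsSoficDyck P X) :
    ∃ F : Set (List A), IsVPL P F ∧ X = {x : ℤ → A | ∀ w : List A, IsFactorOf w x → w ∉ F} := by
  obtain ⟨N, 𝒜, -, rfl⟩ := hX
  set D := 𝒜.toNMachine.summary
  have hF : ∀ w : List A, (D.run P w.reverse).1 = ∅ ↔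
      ¬ ∃ π q, AdmissibleHistory P 𝒜 π q ∧ pathLabel π = w.reverse := by
    intro w
    have := fun q => 𝒜.toNMachine.exists_reach_iff P w.reverse q
    simp only [DyckAutomaton.reach_iff] at this
    rw [← Set.not_nonempty_iff_eq_empty, not_iff_not]
    constructor
    swap
    · rintro ⟨π, q, hπ, hlab⟩
      obtain ⟨p, hp⟩ := (this q).1 ⟨_, π, hπ, hlab, rfl⟩
      exact ⟨_, hp⟩
    · rintro ⟨⟨p, q⟩, hp⟩
      obtain ⟨_, π, hπ, hlab, -⟩ := (this q).2 ⟨p, hp⟩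
      exact ⟨π, q, hπ, hlab⟩
  refine ⟨_, D.isVPL {T | T = ∅}, ?_⟩
  ext x
  simp only [Set.mem_ofPred_eq, mem_presents_iff, exists_isAdmissible_iff, hF, not_not]
  constructor
  · rintro h w ⟨i, hw⟩
    have hwi := h i w.length
    rw [← hw] at hwi
    rcases hwi with rfl | hπ
    · rcases h i 1 with h1 | ⟨-, q, -⟩
      · simpa using congrArg List.length h1
      · exact ⟨[], q, trivial, rfl⟩
    · exact hπ
  · intro h i n
    exact Or.inr (h _ (isFactorOf_factorAt x i n))

end Complement

section Suffixes

variable {A Q Γ : Type*} {P : PushdownAlphabet A}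

/-- The states in which the machine `N.suffixes` may be before any letter of the suffix is read. -/
def NMachine.Fresh (N : NMachine A Q Γ) : Option Q → Prop
  | none => True
  | some q => N.start q

/-- The machine guessing a suffix of its input and simulating `N` on it. The symbols pushed before
the suffix starts are `none`, and are treated as the bottom of the stack later on. -/
def NMachine.suffixes (N : NMachine A Q Γ) : NMachine A (Option Q) (Option Γ) where
  start := N.Fresh
  push o a o' g :=
    match o with
    | none => N.Fresh o' ∧ g = none
    | some p => ∃ q γ, o' = some q ∧ g = some γ ∧ N.push p a q γ
  pop o a g o' :=
    match o with
    | none => N.Fresh o'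
    | some p => ∃ q, o' = some q ∧
      match g with
      | none => N.bot p a q
      | some γ => N.pop p a γ q
  bot o a o' :=
    match o with
    | none => N.Fresh o'
    | some p => ∃ q, o' = some q ∧ N.bot p a q
  int o a o' :=
    match o with
    | none => N.Fresh o'
    | some p => ∃ q, o' = some q ∧ N.int p a q

/-- Description of the reachable configurations of `N.suffixes`. -/
def NMachine.SuffixReach (P : PushdownAlphabet A) (N : NMachine A Q Γ) (h : List A) :
    Option Q → List (Option Γ) → Prop
  | none, σ => ∃ k, σ = List.replicate k none
  | some q, σ => ∃ h₁ h₂ τ k, h = h₁ ++ h₂ ∧ N.Reach P h₁ q τ ∧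
      σ = τ.map some ++ List.replicate k none

lemma NMachine.Fresh.suffixReach {N : NMachine A Q Γ} {o : Option Q} (ho : N.Fresh o)
    (h : List A) (k : ℕ) : N.SuffixReach P h o (List.replicate k none) := by
  cases o with
  | none => exact ⟨k, rfl⟩
  | some q => exact ⟨[], h, [], k, rfl, ⟨ho, rfl⟩, rfl⟩

lemma NMachine.suffixReach_of_reach {N : NMachine A Q Γ} {h : List A} {o : Option Q}
    {σ : List (Option Γ)} (hr : N.suffixes.Reach P h o σ) : N.SuffixReach P h o σ := by
  induction h generalizing o σ with
  | nil =>
    obtain ⟨ho, rfl⟩ := hr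
    exact NMachine.Fresh.suffixReach ho [] 0
  | cons a h ih =>
    obtain ⟨p, τ, hr₀, hs⟩ := hr
    have hp := ih hr₀
    cases p with
    | none =>
      obtain ⟨k, rfl⟩ := hp
      rcases hk : P.kind a <;> simp only [NMachine.Step, hk, NMachine.suffixes] at hs
      · obtain ⟨_, ⟨ho, rfl⟩, rfl⟩ := hs
        exact ho.suffixReach _ (k + 1)
      · rcases hs with ⟨γ, ho, h'⟩ | ⟨ho, -, rfl⟩
        · cases k with
          | zero => simp at h'
          | succ k =>
            simp only [List.replicate_succ, List.cons.injEq] at h'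
            rw [← h'.2]
            exact ho.suffixReach _ k
        · exact ho.suffixReach _ 0
      · obtain ⟨ho, rfl⟩ := hs
        exact ho.suffixReach _ k
    | some p =>
      obtain ⟨h₁, h₂, τ, k, rfl, hr, rfl⟩ := hp
      rcases hk : P.kind a <;> simp only [NMachine.Step, hk, NMachine.suffixes] at hs
      · obtain ⟨_, ⟨q, γ, rfl, rfl, hpush⟩, rfl⟩ := hs
        exact ⟨a :: h₁, h₂, γ :: τ, k, rfl,
          ⟨p, τ, hr, .of_push hk hpush⟩, rfl⟩
      · rcases hs with ⟨γ, ⟨q, rfl, hpop⟩, h'⟩ | ⟨⟨q, rfl, hbot⟩, h', rfl⟩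
        · cases τ with
          | nil =>
            cases k with
            | zero => simp at h'
            | succ k =>
              simp only [List.map_nil, List.nil_append, List.replicate_succ,
                List.cons.injEq] at h'
              obtain ⟨rfl, rfl⟩ := h'
              exact ⟨a :: h₁, h₂, [], k, rfl, ⟨p, [], hr, .of_bot hk hpop⟩, rfl⟩
          | cons δ τ =>
            simp only [List.map_cons, List.cons_append, List.cons.injEq] at h'
            obtain ⟨rfl, rfl⟩ := h'
            exact ⟨a :: h₁, h₂, τ, k, rfl, ⟨p, δ :: τ, hr, .of_pop hk hpop⟩, rfl⟩
        · obtain rfl : τ = [] := by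
            cases τ with
            | nil => rfl
            | cons => simp at h'
          exact ⟨a :: h₁, h₂, [], 0, rfl, ⟨p, [], hr, .of_bot hk hbot⟩, rfl⟩
      · obtain ⟨⟨q, rfl, hint⟩, rfl⟩ := hs
        exact ⟨a :: h₁, h₂, τ, k, rfl,
          ⟨p, τ, hr, .of_int hk hint⟩, rfl⟩

lemma NMachine.reach_suffixes_of_fresh {N : NMachine A Q Γ} (h : List A) {o : Option Q}
    (ho : N.Fresh o) : ∃ k, N.suffixes.Reach P h o (List.replicate k none) := by
  induction h generalizing o with
  | nil => exact ⟨0, ho, rfl⟩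
  | cons a h ih =>
    obtain ⟨k, hr⟩ := ih (o := none) trivial
    rcases hk : P.kind a
    · exact ⟨k + 1, none, _, hr, .of_push hk ⟨ho, rfl⟩⟩
    · cases k with
      | zero =>
        exact ⟨0, none, _, hr, .of_bot hk ho⟩
      | succ k =>
        exact ⟨k, none, _, hr, .of_pop hk ho⟩
    · exact ⟨k, none, _, hr, .of_int hk ho⟩

lemma NMachine.Reach.suffixes {N : NMachine A Q Γ} {h₁ : List A} {q : Q} {σ : List Γ}
    (hr : N.Reach P h₁ q σ) (h₂ : List A) :
    ∃ k, N.suffixes.Reach P (h₁ ++ h₂) (some q) (σ.map some ++ List.replicate k none) := by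
  induction h₁ generalizing q σ with
  | nil =>
    obtain ⟨hq, rfl⟩ := hr
    exact NMachine.reach_suffixes_of_fresh h₂ (o := some q) hq
  | cons a h₁ ih =>
    obtain ⟨p, τ, hr, hs⟩ := hr
    obtain ⟨k, hr⟩ := ih hr
    rcases hk : P.kind a <;> simp only [NMachine.Step, hk] at hs
    · obtain ⟨γ, hpush, rfl⟩ := hs
      exact ⟨k, some p, _, hr, .of_push hk ⟨q, γ, rfl, rfl, hpush⟩⟩
    · rcases hs with ⟨γ, hpop, rfl⟩ | ⟨hbot, rfl, rfl⟩
      · exact ⟨k, some p, _, hr, .of_pop hk ⟨q, rfl, hpop⟩⟩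
      · cases k with
        | zero =>
          exact ⟨0, some p, _, hr, .of_bot hk ⟨q, rfl, hbot⟩⟩
        | succ k =>
          exact ⟨k, some p, _, hr, .of_pop hk ⟨q, rfl, hbot⟩⟩
    · obtain ⟨hint, rfl⟩ := hs
      exact ⟨k, some p, _, hr, .of_int hk ⟨q, rfl, hint⟩⟩

end Suffixes

section Presentation

variable {A S : Type*} (P : PushdownAlphabet A) (D : DMachine A S) (good : S → Prop)

/-- The run of the machine on the given history only visits good states. -/
def DMachine.AllGood (P : PushdownAlphabet A) (D : DMachine A S) (good : S → Prop) :
    List A → Prop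
  | [] => good D.start
  | a :: h => D.AllGood P good h ∧ good (D.run P (a :: h)).1

/-- A configuration is accessible if it is reached by a run through good states. -/
def DMachine.Accessible (s : S) (σ : List (S × A)) : Prop :=
  ∃ h, D.AllGood P good h ∧ D.run P h = (s, σ)

/-- The stacks `σ` with a given top symbol whose top symbol is pushed in an accessible
configuration. -/
def DMachine.Supports : Option (S × A) → List (S × A) → Prop
  | none, σ => σ = []
  | some t, σ => ∃ τ, σ = t :: τ ∧ D.Accessible P good t.1 τ

/-- The state `s` is accessible with any supported stack with top `e`, and there is one. -/
def DMachine.Link (e : Option (S × A)) (s : S) : Prop :=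
  (∃ σ, D.Supports P good e σ) ∧ ∀ σ, D.Supports P good e σ → D.Accessible P good s σ

/-- Every state recorded in a configuration is linked with the symbol below it. -/
def DMachine.Linked (P : PushdownAlphabet A) (D : DMachine A S) (good : S → Prop) :
    S → List (S × A) → Prop
  | s, [] => D.Link P good none s
  | s, t :: σ => D.Link P good (some t) s ∧ D.Linked P good t.1 σ

/-- The effect of a letter on a state and the top symbol of the stack, where the symbol
uncovered by a pop is any one compatible with the popped symbol. -/
def DMachine.Move (s : S) (e : Option (S × A)) (a : A) (s' : S) (e' : Option (S × A)) : Prop :=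
  match P.kind a with
  | LetterKind.call => s' = D.call s a ∧ e' = some (s, a)
  | LetterKind.ret =>
    match e with
    | none => s' = D.bot s a ∧ e' = none
    | some t => s' = D.ret t.1 t.2 s a ∧ D.Link P good e' t.1
  | LetterKind.intern => s' = D.int s a ∧ e' = e

/-- The Dyck automaton presenting the sequences along which the machine stays in good states. -/
def DMachine.toDyckAutomaton : DyckAutomaton A (S × Option (S × A)) where
  edges := {x | D.Link P good x.1.2 x.1.1 ∧ good x.2.2.1 ∧
    D.Move P good x.1.1 x.1.2 x.2.1 x.2.2.1 x.2.2.2}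
  matched := {x |
    (D.Link P good x.1.1.2 x.1.1.1 ∧ good x.1.2.2.1 ∧
      D.Move P good x.1.1.1 x.1.1.2 x.1.2.1 x.1.2.2.1 x.1.2.2.2) ∧
    (D.Link P good x.2.1.2 x.2.1.1 ∧ good x.2.2.2.1 ∧
      D.Move P good x.2.1.1 x.2.1.2 x.2.2.1 x.2.2.2.1 x.2.2.2.2) ∧
    P.kind x.1.2.1 = LetterKind.call ∧ P.kind x.2.2.1 = LetterKind.ret ∧
    x.2.1.2 = some (x.1.1.1, x.1.2.1) ∧ x.2.2.2.2 = x.1.1.2}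

lemma DMachine.toDyckAutomaton_wellFormed : (D.toDyckAutomaton P good).WellFormed P :=
  fun _ _ h => ⟨h.1, h.2.1, h.2.2.1, h.2.2.2.1⟩

variable {P D good}

lemma DMachine.Accessible.step {s : S} {σ : List (S × A)} (hs : D.Accessible P good s σ) {a : A}
    (ha : good (D.step P a (s, σ)).1) :
    D.Accessible P good (D.step P a (s, σ)).1 (D.step P a (s, σ)).2 := by
  obtain ⟨h, hh, hr⟩ := hs
  rw [← hr] at ha ⊢
  exact ⟨a :: h, ⟨hh, ha⟩, rfl⟩

/-- The target of a move from a linked pair is linked. -/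
lemma DMachine.Link.move {s s' : S} {e e' : Option (S × A)} {a : A} (h : D.Link P good e s)
    (hs' : good s') (hm : D.Move P good s e a s' e') : D.Link P good e' s' := by
  rcases hk : P.kind a <;> simp only [DMachine.Move, hk] at hm
  · obtain ⟨rfl, rfl⟩ := hm
    refine ⟨?_, ?_⟩
    · obtain ⟨σ, hσ⟩ := h.1
      exact ⟨_, σ, rfl, h.2 σ hσ⟩
    · rintro _ ⟨τ, rfl, hτ⟩
      simpa [DMachine.step, hk] using hτ.step (a := a) (by simpa [DMachine.step, hk] using hs')
  · cases e with
    | none =>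
      obtain ⟨rfl, rfl⟩ := hm
      refine ⟨h.1, fun σ hσ => ?_⟩
      have := h.2 σ hσ
      obtain rfl : σ = [] := hσ
      simpa [DMachine.step, hk] using this.step (a := a) (by simpa [DMachine.step, hk] using hs')
    | some t =>
      obtain ⟨rfl, ht⟩ := hm
      refine ⟨ht.1, fun σ hσ => ?_⟩
      have := h.2 (t :: σ) ⟨σ, rfl, ht.2 σ hσ⟩
      simpa [DMachine.step, hk] using this.step (a := a) (by simpa [DMachine.step, hk] using hs')
  · obtain ⟨rfl, rfl⟩ := hm
    refine ⟨h.1, fun σ hσ => ?_⟩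
    simpa [DMachine.step, hk] using
      (h.2 σ hσ).step (a := a) (by simpa [DMachine.step, hk] using hs')

lemma DMachine.Linked.link {s : S} {σ : List (S × A)} (h : D.Linked P good s σ) :
    D.Link P good σ.head? s := by
  cases σ with
  | nil => exact h
  | cons t σ => exact h.1

lemma DMachine.Linked.of_link {s s' : S} {σ : List (S × A)} (h : D.Linked P good s σ)
    (h' : D.Link P good σ.head? s') : D.Linked P good s' σ := by
  cases σ with
  | nil => exact h'
  | cons t σ => exact ⟨h', h.2⟩

lemma DMachine.Linked.move {s : S} {σ : List (S × A)} {a : A} (h : D.Linked P good s σ) :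
    D.Move P good s σ.head? a (D.step P a (s, σ)).1 (D.step P a (s, σ)).2.head? := by
  rcases hk : P.kind a <;> simp only [DMachine.Move, DMachine.step, hk]
  · simp
  · cases σ with
    | nil => simp
    | cons t σ => exact ⟨rfl, h.2.link⟩
  · simp

lemma DMachine.Linked.step {s : S} {σ : List (S × A)} {a : A} (h : D.Linked P good s σ)
    (ha : good (D.step P a (s, σ)).1) :
    D.Linked P good (D.step P a (s, σ)).1 (D.step P a (s, σ)).2 := by
  have hl := h.link.move ha h.move
  rcases hk : P.kind a <;> simp only [DMachine.step, hk] at hl ⊢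
  · exact ⟨hl, h⟩
  · cases σ with
    | nil => exact hl
    | cons t σ => exact h.2.of_link hl
  · exact h.of_link hl

lemma DMachine.AllGood.linked {h : List A} (hh : D.AllGood P good h) :
    D.Linked P good (D.run P h).1 (D.run P h).2 := by
  induction h with
  | nil =>
    refine ⟨⟨[], rfl⟩, ?_⟩
    rintro σ rfl
    exact ⟨[], hh, rfl⟩
  | cons a h ih => exact (ih hh.1).step hh.2

/-- The stack symbol pushed along a call edge of `D.toDyckAutomaton`. -/
def stackSymbol (c : (S × Option (S × A)) × A × (S × Option (S × A))) : S × A := (c.1.1, c.2.1)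

/-- A chain of pending call edges, in which each edge records as top symbol the one pushed by the
next edge; `e` is the current top symbol, `d` the one at the end of the chain. -/
def DMachine.PendingChain (P : PushdownAlphabet A) (D : DMachine A S) (good : S → Prop) :
    Option (S × A) →
    List ((S × Option (S × A)) × A × (S × Option (S × A))) → Option (S × A) → Prop
  | e, [], d => e = d
  | e, c :: cs, d => c ∈ (D.toDyckAutomaton P good).edges ∧ P.kind c.2.1 = LetterKind.call ∧
      e = some (stackSymbol c) ∧ D.PendingChain P good c.1.2 cs d

/-- Runs through good states lift to admissible paths. -/
lemma DMachine.AllGood.exists_admissibleHistory {h : List A} (hh : D.AllGood P good h) :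
    ∃ π, AdmissibleHistory P (D.toDyckAutomaton P good) π
        ((D.run P h).1, (D.run P h).2.head?) ∧ pathLabel π = h ∧
      (pending P π).map stackSymbol = (D.run P h).2 ∧
      D.PendingChain P good (D.run P h).2.head? (pending P π) none := by
  induction h with
  | nil => exact ⟨[], trivial, rfl, rfl, rfl⟩
  | cons a h ih =>
    obtain ⟨π, hπ, hlab, hst, hch⟩ := ih hh.1
    have hl := hh.1.linked
    have hg := hh.2
    rw [DMachine.run_cons] at hg ⊢
    generalize D.run P h = c at *
    obtain ⟨s, σ⟩ := c
    have hf : ((s, σ.head?), a, (D.step P a (s, σ)).1, (D.step P a (s, σ)).2.head?) ∈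
        (D.toDyckAutomaton P good).edges := ⟨hl.link, hg, hl.move⟩
    refine ⟨_ :: π, ⟨hf, rfl, hπ, ?_⟩, by simpa [pathLabel] using hlab, ?_⟩
    · intro hk e he
      rcases hp : pending P π with _ | ⟨d, cs⟩
      · simp [hp] at he
      · rw [hp] at he hch hst
        obtain rfl : d = e := by simpa using he
        obtain ⟨hd, hdk, htop, hch⟩ := hch
        refine ⟨hd, hf, hdk, hk, htop, ?_⟩
        simp only at hst hk
        subst hst
        simp only [DMachine.step, hk, List.map_cons]
        cases cs with
        | nil => exact hch.symm
        | cons d' cs => exact hch.2.2.1.symm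
    · rcases hk : P.kind a <;> simp only [pending, hk, DMachine.step]
      · simp only [DMachine.step, hk] at hf
        exact ⟨by simp [hst, stackSymbol], hf, hk, rfl, hch⟩
      · rcases hp : pending P π with _ | ⟨d, cs⟩
        · rw [hp] at hst
          simp only at hst
          subst hst
          exact ⟨rfl, rfl⟩
        · rw [hp] at hst hch
          simp only at hst
          subst hst
          obtain ⟨-, -, -, hch⟩ := hch
          refine ⟨rfl, ?_⟩
          cases cs with
          | nil => exact rfl
          | cons d' cs => exact ⟨hch.1, hch.2.1, rfl, hch.2.2.2⟩
      · exact ⟨hst, hch⟩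

/-- A nonempty admissible path is labeled by a factor of a run through good states. -/
lemma DMachine.exists_accessible_of_admissibleHistory
    {π : List ((S × Option (S × A)) × A × (S × Option (S × A)))} {s : S} {e : Option (S × A)}
    (hπ : AdmissibleHistory P (D.toDyckAutomaton P good) π (s, e)) (hl : D.Link P good e s) :
    ∃ e', D.PendingChain P good e (pending P π) e' ∧ (∃ σ, D.Supports P good e' σ) ∧
      ∀ σ, D.Supports P good e' σ → ∃ h, D.AllGood P good h ∧ pathLabel π <+: h ∧
        D.run P h = (s, (pending P π).map stackSymbol ++ σ) := by
  induction π generalizing s e with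
  | nil =>
    refine ⟨e, rfl, hl.1, fun σ hσ => ?_⟩
    obtain ⟨h, hh, hr⟩ := hl.2 σ hσ
    exact ⟨h, hh, List.nil_prefix, hr⟩
  | cons f π ih =>
    obtain ⟨hf, hq, hπ, hm⟩ := hπ
    obtain ⟨⟨r, d⟩, a, q⟩ := f
    obtain rfl : q = (s, e) := hq
    obtain ⟨hlr, hgs, hmove⟩ := id hf
    simp only at hlr hgs hmove hm
    obtain ⟨e', hch, ⟨σ₀, hσ₀⟩, hrun⟩ := ih hπ hlr
    have hcons : ∀ {h : List A} {τ : List (S × A)}, D.AllGood P good h → pathLabel π <+: h →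
        D.run P h = (r, τ) → (D.step P a (r, τ)).1 = s →
        ∃ h, D.AllGood P good h ∧ pathLabel (((r, d), a, (s, e)) :: π) <+: h ∧
          D.run P h = (s, (D.step P a (r, τ)).2) := by
      intro h τ hh hpre hr hs
      refine ⟨a :: h, ⟨hh, ?_⟩, ?_, ?_⟩
      · rw [DMachine.run_cons, hr, hs]
        exact hgs
      · simpa [pathLabel] using hpre
      · rw [DMachine.run_cons, hr, ← hs]
    rcases hk : P.kind a <;> simp only [DMachine.Move, hk] at hmove
    · obtain ⟨rfl, rfl⟩ := hmove
      refine ⟨e', ?_, ⟨σ₀, hσ₀⟩, fun σ hσ => ?_⟩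
      · simpa only [pending, hk] using ⟨hf, hk, rfl, hch⟩
      · obtain ⟨h, hh, hpre, hr⟩ := hrun σ hσ
        simpa [DMachine.step, hk, pending, stackSymbol] using
          hcons hh hpre hr (by simp [DMachine.step, hk])
    · rcases hp : pending P π with _ | ⟨c, cs⟩
      · rw [hp] at hch hrun
        obtain rfl : d = e' := hch
        simp only [pending, hk, hp, List.tail_nil]
        cases d with
        | none =>
          obtain ⟨rfl, rfl⟩ := hmove
          refine ⟨none, rfl, ⟨[], rfl⟩, ?_⟩
          rintro σ rfl
          obtain ⟨h, hh, hpre, hr⟩ := hrun [] rfl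
          simpa [DMachine.step, hk] using hcons hh hpre hr (by simp [DMachine.step, hk])
        | some t =>
          obtain ⟨rfl, ht⟩ := hmove
          refine ⟨e, rfl, ht.1, fun σ hσ => ?_⟩
          obtain ⟨h, hh, hpre, hr⟩ := hrun (t :: σ) ⟨σ, rfl, ht.2 σ hσ⟩
          simpa [DMachine.step, hk] using hcons hh hpre hr (by simp [DMachine.step, hk])
      · rw [hp] at hch hrun
        obtain ⟨-, -, -, -, htop, huncov⟩ := hm hk c (by simp [hp])
        simp only at htop huncov
        subst htop huncov
        obtain ⟨rfl, ht⟩ := hmove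
        simp only [pending, hk, hp, List.tail_cons]
        refine ⟨e', hch.2.2.2, ⟨σ₀, hσ₀⟩, fun σ hσ => ?_⟩
        obtain ⟨h, hh, hpre, hr⟩ := hrun σ hσ
        simpa [DMachine.step, hk, stackSymbol] using
          hcons hh hpre hr (by simp [DMachine.step, hk, stackSymbol])
    · obtain ⟨rfl, rfl⟩ := hmove
      refine ⟨e', by simpa only [pending, hk] using hch, ⟨σ₀, hσ₀⟩, fun σ hσ => ?_⟩
      obtain ⟨h, hh, hpre, hr⟩ := hrun σ hσ
      simpa [DMachine.step, hk, pending] using hcons hh hpre hr (by simp [DMachine.step, hk])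

/-- The automaton `D.toDyckAutomaton P good` presents the sequences all of whose factors keep the
machine in good states. -/
theorem DMachine.mem_presents_iff_allGood [Finite A] [Finite S]
    (hpre : ∀ h₁ h₂, D.AllGood P good (h₁ ++ h₂) → D.AllGood P good h₁) {x : ℤ → A} :
    x ∈ presents P (D.toDyckAutomaton P good) ↔
      ∀ w, IsFactorOf w x → D.AllGood P good w.reverse := by
  constructor
  · rintro ⟨π, hπ, hx⟩ w ⟨i, hw⟩
    have hadm := hπ.2.2 i w.length
    have hlink : D.Link P good (π (i + w.length)).1.2 (π (i + w.length)).1.1 := (hπ.1 _).1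
    have hlab : pathLabel (pathSeg π i w.length) = w := by
      conv_rhs => rw [hw]
      rw [pathSeg_eq_factorAt, pathLabel, map_factorAt]
      exact congrArg (fun y => factorAt y i w.length) (funext hx)
    have hhist : AdmissibleHistory P (D.toDyckAutomaton P good)
        (pathSeg π i w.length).reverse (π (i + w.length)).1 := by
      rw [admissibleHistory_iff, List.reverse_reverse]
      refine ⟨hadm, ?_⟩
      rw [pathSeg_eq_factorAt]
      rcases w.length with _ | n
      · simp [factorAt_eq_map]
      · simp [factorAt_eq_map, List.range_succ, hπ.2.1 (i + n), add_assoc]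
    obtain ⟨e', -, ⟨σ, hσ⟩, hrun⟩ :=
      DMachine.exists_accessible_of_admissibleHistory hhist hlink
    obtain ⟨h, hh, ⟨h₂, rfl⟩, -⟩ := hrun σ hσ
    have := hpre _ _ hh
    rwa [← hlab, pathLabel, ← List.map_reverse]
  · intro h
    rw [mem_presents_iff]
    intro i n
    obtain ⟨π, hπ, hlab, -⟩ := (h _ (isFactorOf_factorAt x i n)).exists_admissibleHistory
    exact exists_isAdmissible_iff.2 (Or.inr ⟨π, _, hπ, hlab⟩)

end Presentation

/-- The sequences avoiding a visibly pushdown language form a sofic-Dyck shift. -/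
theorem IsVPL.isSoficDyck {A : Type*} [Finite A] {P : PushdownAlphabet A} {F : Set (List A)}
    (hF : IsVPL P F) :
    IsSoficDyck P {x : ℤ → A | ∀ w : List A, IsFactorOf w x → w ∉ F} := by
  obtain ⟨nQ, nΓ, V, rfl⟩ := hF
  set D := V.toNMachine.suffixes.summary
  let good : Set (Option (Fin nQ) × Option (Fin nQ)) → Prop := fun T =>
    ∀ p, ∀ q ∈ V.final, (p, some q) ∉ T
  have hgood : ∀ h, good (D.run P h).1 ↔
      ∀ h₁ h₂, h = h₁ ++ h₂ → ¬ VPA.Accepts P V h₁.reverse := by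
    intro h
    have hreach := fun q => V.toNMachine.suffixes.exists_reach_iff P h (some q)
    simp only [VPA.accepts_iff, List.reverse_reverse]
    constructor
    · rintro hg h₁ h₂ rfl ⟨q, hq, σ, hr⟩
      obtain ⟨k, hr⟩ := hr.suffixes h₂
      obtain ⟨p, hp⟩ := (hreach q).1 ⟨_, hr⟩
      exact hg p q hq hp
    · intro hno p q hq hp
      obtain ⟨σ, hr⟩ := (hreach q).2 ⟨p, hp⟩
      obtain ⟨h₁, h₂, τ, -, rfl, hr, -⟩ := NMachine.suffixReach_of_reach hr
      exact hno h₁ h₂ rfl ⟨q, hq, τ, hr⟩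
  have hall : ∀ h, D.AllGood P good h ↔
      ∀ u, u <:+: h.reverse → ¬ VPA.Accepts P V u := by
    intro h
    induction h with
    | nil =>
      refine (hgood []).trans ⟨fun hno u hu => ?_, fun hno h₁ h₂ hh => ?_⟩
      · obtain rfl : u = [] := by simpa using hu
        exact hno [] [] rfl
      · obtain ⟨rfl, rfl⟩ := List.append_eq_nil_iff.1 hh.symm
        exact hno [] (List.infix_refl _)
    | cons a h ih =>
      rw [DMachine.AllGood, ih, hgood]
      constructor
      · rintro ⟨hno, hno'⟩ u hu
        rw [← List.reverse_infix, List.reverse_reverse, List.infix_cons_iff] at hu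
        rcases hu with ⟨h₂, hu⟩ | hu
        · simpa using hno' _ _ hu.symm
        · exact hno u (by simpa using List.reverse_infix.2 hu)
      · refine fun hno => ⟨fun u hu => hno u ?_, fun h₁ h₂ hh => hno _ ?_⟩
        · rw [List.reverse_cons]
          exact hu.trans (List.prefix_append _ _).isInfix
        · rw [hh, List.reverse_append]
          exact (List.suffix_append _ _).isInfix
  have hX : {x : ℤ → A | ∀ w : List A, IsFactorOf w x → w ∉ {w | VPA.Accepts P V w}} =
      presents P (D.toDyckAutomaton P good) := by
    ext x
    rw [DMachine.mem_presents_iff_allGood]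
    · simp only [hall, List.reverse_reverse, Set.mem_ofPred_eq]
      constructor
      · rintro h w ⟨i, hw⟩ u hu
        rw [hw] at hu
        exact h u (isFactorOf_of_infix hu)
      · exact fun h w hw => h w hw w (List.infix_refl _)
    · intro h₁ h₂
      simp only [hall]
      intro h u hu
      refine h u (hu.trans ?_)
      rw [List.reverse_append]
      exact (List.suffix_append _ _).isInfix
  rw [hX]
  exact isSoficDyck_presents (D.toDyckAutomaton_wellFormed P good)

end SD

open SD

/-- Sofic-Dyck shifts are exactly the shifts `X_F` avoiding a visibly pushdown
language `F` of forbidden factors. -/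
theorem statement_15 {A : Type*} [Fintype A] (P : PushdownAlphabet A)
    (X : Set (ℤ → A)) :
    IsSoficDyck P X ↔
      ∃ F : Set (List A), IsVPL P F ∧
        X = { x : ℤ → A | ∀ w : List A, IsFactorOf w x → w ∉ F } := by
  constructor
  · exact IsSoficDyck.exists_isVPL
  · rintro ⟨F, hF, rfl⟩
    exact hF.isSoficDyck
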